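/- Let X be a dendroid in the plane and let S ⊂ ℝ² be a circle with bounded complementary component U and unbounded complementary component V, such that X meets V. If W is a connected open subset of U such that X \ W is connected, then the union W' of W with all bounded complementary components of W is a simply connected domain contained in U, with W ⊂ W' and X \ W' connected. -/

import Mathlib

open Set Filter Topology

/-- The Euclidean plane. -/
abbrev Plane := EuclideanSpace ℝ (Fin 2)

section Defs

variable {α : Type*} [TopologicalSpace α]

/-- `A` is an arc with endpoints `a` and `b`: a homeomorphic image of `[0,1]`
sending `0 ↦ a` and `1 ↦ b`. -/
def IsArcWithEndpoints (A : Set α) (a b : α) : Prop :=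
  ∃ f : ℝ → α, ContinuousOn f (Set.Icc 0 1) ∧ Set.InjOn f (Set.Icc 0 1) ∧
    f '' (Set.Icc 0 1) = A ∧ f 0 = a ∧ f 1 = b

/-- `A` is an arc. -/
def IsArc (A : Set α) : Prop := ∃ a b, IsArcWithEndpoints A a b

/-- Every two distinct points of `X` are joined by an arc inside `X`. -/
def ArcwiseConnected (X : Set α) : Prop :=
  ∀ x ∈ X, ∀ y ∈ X, x ≠ y → ∃ A, A ⊆ X ∧ IsArcWithEndpoints A x y

/-- Every two subcontinua of `X` have connected intersection. -/
def HereditarilyUnicoherent (X : Set α) : Prop :=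
  ∀ K L : Set α, K ⊆ X → L ⊆ X → IsCompact K → IsConnected K →
    IsCompact L → IsConnected L → IsPreconnected (K ∩ L)

/-- A dendroid: a hereditarily unicoherent, arcwise connected continuum. -/
def IsDendroid (X : Set α) : Prop :=
  IsCompact X ∧ IsConnected X ∧ HereditarilyUnicoherent X ∧ ArcwiseConnected X

/-- The set of endpoints of `X`: points that are endpoints of every arc in `X`
containing them. -/
def Endpoints (X : Set α) : Set α :=
  {e | e ∈ X ∧ ∀ A : Set α, A ⊆ X → IsArc A → e ∈ A → ∃ b, IsArcWithEndpoints A e b}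

/-- `X` is Suslinian: every collection of pairwise-disjoint non-degenerate
subcontinua of `X` is countable. -/
def IsSuslinian (X : Set α) : Prop :=
  ∀ S : Set (Set α), (∀ K ∈ S, K ⊆ X ∧ IsCompact K ∧ IsConnected K ∧ K.Nontrivial) →
    S.PairwiseDisjoint id → S.Countable

/-- The arc component of `x` inside the set `S`. -/
def arcComponentIn (S : Set α) (x : α) : Set α :=
  {y | y ∈ S ∧ (y = x ∨ ∃ A, A ⊆ S ∧ IsArcWithEndpoints A x y)}

/-- The collection of arc components of `X \ {x}`; its cardinality is the order of `x`. -/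
def orderComponents (X : Set α) (x : α) : Set (Set α) :=
  {C | ∃ y ∈ X \ {x}, C = arcComponentIn (X \ {x}) y}

/-- Ramification points of `X`: points of order at least 3. -/
def RamificationPoints (X : Set α) : Set α :=
  {x | x ∈ X ∧ 3 ≤ (orderComponents X x).encard}

/-- `A` is a clopen subset of the subspace `Y`. -/
def IsClopenIn (Y A : Set α) : Prop :=
  A ⊆ Y ∧ (∃ U, IsOpen U ∧ A = Y ∩ U) ∧ (∃ C, IsClosed C ∧ A = Y ∩ C)

/-- The quasicomponent of `x` in the subspace `Y`: the intersection of all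
clopen subsets of `Y` containing `x`. -/
def quasicomponentIn (Y : Set α) (x : α) : Set α :=
  {y ∈ Y | ∀ A : Set α, IsClopenIn Y A → x ∈ A → y ∈ A}

/-- `Y` is hereditarily disconnected: it contains no non-degenerate connected subset. -/
def HereditarilyDisconnected (Y : Set α) : Prop :=
  ∀ S : Set α, S ⊆ Y → IsPreconnected S → S.Subsingleton

end Defs

/-- The point `x` of `X` is (arcwise) accessible from `ℝ² \ X`. -/
def AccessiblePoint (X : Set Plane) (x : Plane) : Prop :=
  ∃ A : Set Plane, IsArc A ∧ A ∩ X = {x}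

/-- `σ` separates the points `b` and `d` in the plane: no connected subset of the
complement of `σ` contains both. -/
def SeparatesPoints (σ : Set Plane) (b d : Plane) : Prop :=
  b ∉ σ ∧ d ∉ σ ∧ ∀ K : Set Plane, K ⊆ σᶜ → IsPreconnected K → b ∈ K → d ∉ K

/-- A simple closed curve in the plane: the image of a period-1 parametrization
injective on `[0,1)`. -/
def IsSimpleClosedCurve (O : Set Plane) : Prop :=
  ∃ f : ℝ → Plane, Continuous f ∧ Function.Periodic f 1 ∧
    Set.InjOn f (Set.Ico 0 1) ∧ f '' (Set.Ico 0 1) = O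

/-- The dendroid `X` is smooth at `p`: there is a choice `arcTo x` of the unique arc
from `x` to `p` (reduced to `{p}` for `x = p`) such that `xₙ → x` in `X` implies
`arcTo xₙ → arcTo x` in the Hausdorff distance. -/
def DendroidSmoothAt (X : Set Plane) (p : Plane) : Prop :=
  p ∈ X ∧ ∃ arcTo : Plane → Set Plane,
    arcTo p = {p} ∧
    (∀ x ∈ X, x ≠ p → arcTo x ⊆ X ∧ IsArcWithEndpoints (arcTo x) x p) ∧
    (∀ (xs : ℕ → Plane) (x : Plane), (∀ n, xs n ∈ X) → x ∈ X →
      Filter.Tendsto xs Filter.atTop (nhds x) →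
      Filter.Tendsto (fun n => EMetric.hausdorffEdist (arcTo (xs n)) (arcTo x))
        Filter.atTop (nhds 0))

/-- A space is zero-dimensional if it has a basis of clopen sets. -/
def IsZeroDimensionalSpace (β : Type*) [TopologicalSpace β] : Prop :=
  ∀ (x : β) (U : Set β), IsOpen U → x ∈ U → ∃ V : Set β, IsClopen V ∧ x ∈ V ∧ V ⊆ U

/-- A space is almost zero-dimensional if it has a neighborhood basis of sets
which are intersections of clopen sets. -/
def IsAlmostZeroDimensionalSpace (β : Type*) [TopologicalSpace β] : Prop :=
  ∀ (x : β) (U : Set β), IsOpen U → x ∈ U →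
    ∃ V : Set β, V ∈ nhds x ∧ V ⊆ U ∧
      ∃ 𝒞 : Set (Set β), (∀ C ∈ 𝒞, IsClopen C) ∧ V = ⋂₀ 𝒞

/-- The union of `W` with all of the bounded connected components of its complement. -/
def boundedComplementaryFill (W : Set Plane) : Set Plane :=
  W ∪ ⋃₀ {K | (∃ x ∈ Wᶜ, K = connectedComponentIn Wᶜ x) ∧ Bornology.IsBounded K}

/-- A Bellamy dendroid: a (non-degenerate) smooth plane dendroid whose endpoint
set is connected. -/
def IsBellamyDendroid (K : Set Plane) : Prop :=
  IsDendroid K ∧ K.Nontrivial ∧ (∃ q, DendroidSmoothAt K q) ∧ IsConnected (Endpoints K)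

/-- The middle-thirds Cantor set. -/
noncomputable def cantorC : Set ℝ :=
  {x | ∃ a : ℕ → Bool, x = ∑' i, (if a i then (2 : ℝ) else 0) / 3 ^ (i + 1)}

/-- Lattice cells that share at least a corner. -/
def KingAdj (a b : ℤ × ℤ) : Prop := |a.1 - b.1| ≤ 1 ∧ |a.2 - b.2| ≤ 1

/-- Lattice cells that share an edge. -/
def RookAdj (a b : ℤ × ℤ) : Prop := |a.1 - b.1| + |a.2 - b.2| = 1

/-- A king move that avoids `G`. -/
def KingStep (G : Set (ℤ × ℤ)) (a b : ℤ × ℤ) : Prop := KingAdj a b ∧ a ∉ G ∧ b ∉ G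

/-- `q` can be joined by king moves avoiding `G` to a cell above all cells of `G`. -/
def EscapesUp (G : Set (ℤ × ℤ)) (q : ℤ × ℤ) : Prop :=
  ∃ q', (∀ c ∈ G, c.2 ≤ q'.2) ∧ Relation.ReflTransGen (KingStep G) q q'

theorem RookAdj.symm {a b : ℤ × ℤ} (h : RookAdj a b) : RookAdj b a := by
  unfold RookAdj at *
  rwa [abs_sub_comm b.1, abs_sub_comm b.2]

theorem RookAdj.kingAdj {a b : ℤ × ℤ} (h : RookAdj a b) : KingAdj a b := by
  unfold RookAdj at h
  have h1 := abs_nonneg (a.1 - b.1)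
  have h2 := abs_nonneg (a.2 - b.2)
  exact ⟨by lia, by lia⟩

/-- If `q` escapes from `G`, then the cochain counting signed crossings of the vertical ray above
the left edge of `q` is a coboundary on `G`. -/
theorem EscapesUp.exists_potential {G : Set (ℤ × ℤ)} {q : ℤ × ℤ} (hq : EscapesUp G q) :
    ∃ φ : ℤ × ℤ → ℤ, (∀ i j, (i, j) ∈ G → (i, j + 1) ∈ G → φ (i, j + 1) = φ (i, j)) ∧
      ∀ i j, (i, j) ∈ G → (i + 1, j) ∈ G →
        φ (i + 1, j) = φ (i, j) + if i + 1 = q.1 ∧ q.2 < j then 1 else 0 := by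
  obtain ⟨q', hq', hpath⟩ := hq
  induction hpath using Relation.ReflTransGen.head_induction_on with
  | refl =>
    refine ⟨fun _ => 0, fun _ _ _ _ => rfl, fun i j hij _ => ?_⟩
    have := hq' _ hij
    rw [if_neg (by rintro ⟨-, h⟩; simp only at this; lia)]
    rfl
  | @head k' k hstep _ ih =>
    obtain ⟨φ, hv, hh⟩ := ih
    obtain ⟨⟨h1, h2⟩, hk', hk⟩ := hstep
    obtain ⟨a, b⟩ := k
    obtain ⟨a', b'⟩ := k'
    simp only [abs_le] at h1 h2 hh ⊢
    have ne : ∀ {i j : ℤ}, (i, j) ∈ G → (i ≠ a ∨ j ≠ b) ∧ (i ≠ a' ∨ j ≠ b') := by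
      intro i j hij
      constructor
      · by_contra! h
        exact hk (by rw [← h.1, ← h.2]; exact hij)
      · by_contra! h
        exact hk' (by rw [← h.1, ← h.2]; exact hij)
    rcases (by lia : a' = a ∨ a' = a + 1 ∨ a' = a - 1) with h | h | h
    · refine ⟨φ, hv, fun i j hij hij' => ?_⟩
      rw [hh i j hij hij']
      have := ne hij
      have := ne hij'
      split_ifs <;> lia
    · refine ⟨fun c => φ c - if c.1 = a ∧ b < c.2 then 1 else 0, fun i j hij hij' => ?_,
        fun i j hij hij' => ?_⟩
      · have := hv i j hij hij'
        have := ne hij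
        have := ne hij'
        simp only
        split_ifs <;> lia
      · have e := hh i j hij hij'
        have := ne hij
        have := ne hij'
        simp only
        rw [e]
        split_ifs <;> lia
    · refine ⟨fun c => φ c + if c.1 = a' ∧ b' < c.2 then 1 else 0, fun i j hij hij' => ?_,
        fun i j hij hij' => ?_⟩
      · have := hv i j hij hij'
        have := ne hij
        have := ne hij'
        simp only
        split_ifs <;> lia
      · have e := hh i j hij hij'
        have := ne hij
        have := ne hij'
        simp only
        rw [e]
        split_ifs <;> lia

theorem exists_top_left (G : Finset (ℤ × ℤ)) (hG : G.Nonempty) :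
    ∃ p ∈ G, ∀ c ∈ G, c.2 < p.2 ∨ c.2 = p.2 ∧ p.1 ≤ c.1 := by
  obtain ⟨m, hm, hmax⟩ := G.exists_max_image Prod.snd hG
  obtain ⟨p, hp, hmin⟩ := (G.filter fun c => c.2 = m.2).exists_min_image Prod.fst
    ⟨m, by simpa using hm⟩
  rw [Finset.mem_filter] at hp
  refine ⟨p, hp.1, fun c hc => ?_⟩
  rcases (hmax c hc).lt_or_eq with h | h
  · exact Or.inl (hp.2 ▸ h)
  · exact Or.inr ⟨h.trans hp.2.symm, hmin c (Finset.mem_filter.2 ⟨hc, h⟩)⟩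

theorem RookAdj.eq_add {a b : ℤ × ℤ} (h : RookAdj a b) :
    b = (a.1 + 1, a.2) ∨ b = (a.1, a.2 + 1) ∨ a = (b.1 + 1, b.2) ∨ a = (b.1, b.2 + 1) := by
  unfold RookAdj at h
  obtain ⟨a1, a2⟩ := a
  obtain ⟨b1, b2⟩ := b
  simp only [Prod.mk.injEq] at *
  rcases abs_cases (a1 - b1) with h1 | h1 <;> rcases abs_cases (a2 - b2) with h2 | h2 <;> lia

open CategoryTheory in
/-- A groupoid-valued cocycle on a finite set of lattice cells, all of whose complementary cells
escape to infinity, is a coboundary. -/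
theorem exists_cocycle_trivialization {C : Type*} [Groupoid C] (o : ℤ × ℤ → C)
    (f : ∀ a b, o a ⟶ o b) (b₀ : C) (hb₀ : ∀ a, Nonempty (b₀ ⟶ o a)) (G : Finset (ℤ × ℤ))
    (hinv : ∀ a ∈ G, ∀ b ∈ G, RookAdj a b → f a b ≫ f b a = 𝟙 _)
    (hsq : ∀ i j, (i, j) ∈ G → (i, j + 1) ∈ G → (i + 1, j) ∈ G → (i + 1, j + 1) ∈ G →
      f (i, j) (i, j + 1) ≫ f (i, j + 1) (i + 1, j + 1) =
        f (i, j) (i + 1, j) ≫ f (i + 1, j) (i + 1, j + 1))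
    (hesc : ∀ q ∉ G, EscapesUp G q) :
    ∃ P : ∀ a, b₀ ⟶ o a, ∀ a ∈ G, ∀ b ∈ G, RookAdj a b → P a ≫ f a b = P b := by
  classical
  induction hn : G.card generalizing G with
  | zero =>
    rw [Finset.card_eq_zero] at hn
    subst hn
    exact ⟨fun a => (hb₀ a).some, by simp⟩
  | succ n ih =>
    obtain ⟨⟨x, y⟩, hp, htop⟩ := exists_top_left G (Finset.card_pos.1 (by lia))
    have hsub : ∀ a ∈ G.erase (x, y), a ∈ G := fun a ha => Finset.mem_of_mem_erase ha
    have hstep : ∀ a b, KingStep G a b → KingStep (G.erase (x, y)) a b := fun a b h =>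
      ⟨h.1, fun ha => h.2.1 (hsub a ha), fun hb => h.2.2 (hsub b hb)⟩
    have hesc' : ∀ q ∉ G.erase (x, y), EscapesUp (G.erase (x, y)) q := by
      intro q hq
      by_cases hqp : q = (x, y)
      · subst hqp
        refine ⟨(x, y + 1), fun c hc => ?_, Relation.ReflTransGen.single ⟨?_, hq, ?_⟩⟩
        · have := htop c (hsub c hc)
          simp only at *
          lia
        · exact ⟨by simp, by simp⟩
        · intro hc
          have := htop _ (hsub _ hc)
          simp only at this
          lia
      · obtain ⟨q', h1, h2⟩ := hesc q fun h => hq (Finset.mem_erase.2 ⟨hqp, h⟩)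
        exact ⟨q', fun c hc => h1 c (hsub c hc), Relation.ReflTransGen.mono hstep _ _ h2⟩
    obtain ⟨P, hP⟩ := ih (G.erase (x, y))
      (fun a ha b hb => hinv a (hsub a ha) b (hsub b hb))
      (fun i j h1 h2 h3 h4 => hsq i j (hsub _ h1) (hsub _ h2) (hsub _ h3) (hsub _ h4))
      hesc' (by rw [Finset.card_erase_of_mem hp, hn]; rfl)
    have hdp : RookAdj (x, y - 1) (x, y) := by simp [RookAdj]
    have hpr : RookAdj (x, y) (x + 1, y) := by simp [RookAdj]
    have hd_ne : ((x, y - 1) : ℤ × ℤ) ≠ (x, y) := by simp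
    have hr_ne : ((x + 1, y) : ℤ × ℤ) ≠ (x, y) := by simp
    obtain ⟨P₁, hP₁, hdr⟩ : ∃ P₁ : ∀ a, b₀ ⟶ o a,
        (∀ a ∈ G.erase (x, y), ∀ b ∈ G.erase (x, y), RookAdj a b → P₁ a ≫ f a b = P₁ b) ∧
        ((x, y - 1) ∈ G → (x + 1, y) ∈ G →
          P₁ (x, y - 1) ≫ f (x, y - 1) (x, y) ≫ f (x, y) (x + 1, y) = P₁ (x + 1, y)) := by
      by_cases hq : (x + 1, y - 1) ∈ G
      · refine ⟨P, hP, fun hd hr => ?_⟩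
        have h := hsq x (y - 1) hd (by rwa [sub_add_cancel]) hq (by rwa [sub_add_cancel])
        rw [sub_add_cancel] at h
        have hd' := Finset.mem_erase.2 ⟨hd_ne, hd⟩
        have hr' := Finset.mem_erase.2 ⟨hr_ne, hr⟩
        have hq' := Finset.mem_erase.2 ⟨(by simp : ((x + 1, y - 1) : ℤ × ℤ) ≠ (x, y)), hq⟩
        rw [h, ← Category.assoc, hP _ hd' _ hq' (by simp [RookAdj]),
          hP _ hq' _ hr' (by simp [RookAdj])]
      · by_cases hdr : (x, y - 1) ∈ G ∧ (x + 1, y) ∈ G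
        swap
        · exact ⟨P, hP, fun hd hr => absurd ⟨hd, hr⟩ hdr⟩
        obtain ⟨φ, hv, hh⟩ := (hesc _ hq).exists_potential
        have hφd : φ (x, y - 1) ≠ φ (x + 1, y) := by
          have h1 := hv x (y - 1) hdr.1 (by rw [sub_add_cancel]; exact hp)
          have h2 := hh x y hp hdr.2
          rw [sub_add_cancel] at h1
          rw [if_pos ⟨rfl, by simp⟩] at h2
          lia
        have hφ : ∀ a ∈ G.erase (x, y), ∀ b ∈ G.erase (x, y), RookAdj a b → φ a = φ b := by
          have key : ∀ i j, (i, j) ∈ G.erase (x, y) → (i + 1, j) ∈ G.erase (x, y) →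
              φ (i + 1, j) = φ (i, j) := by
            intro i j h1 h2
            rw [hh i j (hsub _ h1) (hsub _ h2), if_neg, add_zero]
            rintro ⟨hi, hj⟩
            have ht := htop _ (hsub _ h1)
            simp only at hi hj ht
            have e1 : i = x := by lia
            have e2 : j = y := by lia
            exact (Finset.mem_erase.1 h1).1 (by rw [e1, e2])
          intro a ha b hb hab
          rcases hab.eq_add with h | h | h | h
          · rw [h] at hb ⊢
            exact (key _ _ ha hb).symm
          · rw [h] at hb ⊢
            exact (hv _ _ (hsub _ ha) (hsub _ hb)).symm
          · rw [h] at ha ⊢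
            exact key _ _ hb ha
          · rw [h] at ha ⊢
            exact hv _ _ (hsub _ hb) (hsub _ ha)
        set g : b₀ ⟶ b₀ := P (x, y - 1) ≫ f (x, y - 1) (x, y) ≫ f (x, y) (x + 1, y) ≫
          Groupoid.inv (P (x + 1, y)) with hg
        refine ⟨fun c => if φ c = φ (x + 1, y) then g ≫ P c else P c, ?_, fun _ _ => ?_⟩
        · intro a ha b hb hab
          have := hP a ha b hb hab
          simp only [hφ a ha b hb hab]
          split_ifs
          · rw [Category.assoc, this]
          · exact this
        · beta_reduce
          rw [if_neg hφd, if_pos rfl, hg]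
          simp
    have hP' : ∃ s : b₀ ⟶ o (x, y), ∀ c ∈ G.erase (x, y), RookAdj c (x, y) →
        P₁ c ≫ f c (x, y) = s := by
      have hc : ∀ c ∈ G.erase (x, y), RookAdj c (x, y) → c = (x, y - 1) ∨ c = (x + 1, y) := by
        rintro ⟨i, j⟩ hc hcp
        have := htop _ (hsub _ hc)
        have h := hcp.eq_add
        simp only [Prod.mk.injEq] at *
        lia
      by_cases hr : (x + 1, y) ∈ G
      · refine ⟨P₁ (x + 1, y) ≫ f (x + 1, y) (x, y), fun c hcG hcp => ?_⟩
        rcases hc c hcG hcp with rfl | rfl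
        · rw [← hdr (hsub _ hcG) hr, Category.assoc, Category.assoc, hinv _ hp _ hr hpr,
            Category.comp_id]
        · rfl
      · refine ⟨P₁ (x, y - 1) ≫ f (x, y - 1) (x, y), fun c hcG hcp => ?_⟩
        rcases hc c hcG hcp with rfl | rfl
        · rfl
        · exact absurd (hsub _ hcG) hr
    obtain ⟨s, hs⟩ := hP'
    refine ⟨Function.update P₁ (x, y) s, fun a ha b hb hab => ?_⟩
    by_cases hap : a = (x, y)
    · have hbp : b ≠ (x, y) := by
        rintro rfl
        simp [RookAdj, hap] at hab
      subst hap
      rw [Function.update_self, Function.update_of_ne hbp,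
        ← hs b (Finset.mem_erase.2 ⟨hbp, hb⟩) hab.symm, Category.assoc, hinv _ hb _ ha hab.symm,
        Category.comp_id]
    · by_cases hbp : b = (x, y)
      · subst hbp
        rw [Function.update_self, Function.update_of_ne hap]
        exact hs a (Finset.mem_erase.2 ⟨hap, ha⟩) hab
      · rw [Function.update_of_ne hap, Function.update_of_ne hbp]
        exact hP₁ a (Finset.mem_erase.2 ⟨hap, ha⟩) b (Finset.mem_erase.2 ⟨hbp, hb⟩) hab

section ConvexPaths

variable {E : Type*} [NormedAddCommGroup E] [NormedSpace ℝ E] {Ω K : Set E}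

/-- Two paths that stay in a common convex subset are homotopic. -/
theorem Path.Homotopic.of_mem_convex (hK : Convex ℝ K) (hKΩ : K ⊆ Ω) {x y : Ω} (p q : Path x y)
    (hp : ∀ t, (p t : E) ∈ K) (hq : ∀ t, (q t : E) ∈ K) : p.Homotopic q := by
  have hx : (x : E) ∈ K := by simpa using hp 0
  have hy : (y : E) ∈ K := by simpa using hp 1
  have := hK.contractibleSpace ⟨_, hx⟩
  let lift : ∀ p : Path x y, (∀ t, (p t : E) ∈ K) → Path (⟨x, hx⟩ : K) ⟨y, hy⟩ := fun p hp =>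
    { toFun := fun t => ⟨p t, hp t⟩
      source' := by simp
      target' := by simp }
  exact (SimplyConnectedSpace.paths_homotopic (lift p hp) (lift q hq)).map
    ⟨Set.inclusion hKΩ, continuous_inclusion hKΩ⟩

theorem Convex.exists_path_mem (hK : Convex ℝ K) (hKΩ : K ⊆ Ω) {x y : Ω} (hx : (x : E) ∈ K)
    (hy : (y : E) ∈ K) : ∃ p : Path x y, ∀ t, (p t : E) ∈ K := by
  obtain ⟨p, hp⟩ := (hK.isPathConnected ⟨_, hx⟩).joinedIn _ hx _ hy
  exact ⟨{ toFun := fun t => ⟨p t, hKΩ (hp t)⟩, source' := by simp, target' := by simp }, hp⟩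

/-- There is a choice of path classes that agrees with the class of every path staying in a
convex subset. -/
theorem exists_segment_class (Ω : Set E) [PathConnectedSpace Ω] :
    ∃ s : ∀ x y : Ω, Path.Homotopic.Quotient x y, ∀ K ⊆ Ω, Convex ℝ K →
      ∀ (x y : Ω) (p : Path x y), (∀ t, (p t : E) ∈ K) → s x y = Path.Homotopic.Quotient.mk p := by
  classical
  refine ⟨fun x y => if h : ∃ p : Path x y, ∀ t, (p t : E) ∈ segment ℝ (x : E) y then
    Path.Homotopic.Quotient.mk h.choose else
    Path.Homotopic.Quotient.mk (PathConnectedSpace.somePath x y), fun K hKΩ hK x y p hp => ?_⟩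
  have hseg : segment ℝ (x : E) y ⊆ K :=
    hK.segment_subset (by simpa using hp 0) (by simpa using hp 1)
  have h : ∃ p : Path x y, ∀ t, (p t : E) ∈ segment ℝ (x : E) y :=
    (convex_segment _ _).exists_path_mem (hseg.trans hKΩ) (left_mem_segment ..)
      (right_mem_segment ..)
  beta_reduce
  rw [dif_pos h, Path.Homotopic.Quotient.eq]
  exact .of_mem_convex hK hKΩ _ _ (fun t => hseg (h.choose_spec t)) hp

end ConvexPaths

/-- The lattice cell of mesh `1 / N` containing `w`. -/
noncomputable def cell (N : ℝ) (w : Plane) : ℤ × ℤ := (⌊N * w 0⌋, ⌊N * w 1⌋)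

/-- The lower left corner of a lattice cell. -/
noncomputable def corner (N : ℝ) (c : ℤ × ℤ) : Plane := !₂[c.1 / N, c.2 / N]

theorem cell_corner {N : ℝ} (hN : 0 < N) (c : ℤ × ℤ) : cell N (corner N c) = c := by
  simp [cell, corner, mul_div_cancel₀ _ hN.ne']

theorem KingAdj.symm {a b : ℤ × ℤ} (h : KingAdj a b) : KingAdj b a := by
  unfold KingAdj at *
  rwa [abs_sub_comm b.1, abs_sub_comm b.2]

theorem abs_apply_sub_le_dist (v w : Plane) (i : Fin 2) : |v i - w i| ≤ dist v w := by
  rw [dist_eq_norm]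
  exact PiLp.norm_apply_le (v - w) i

theorem kingAdj_cell {N : ℝ} (hN : 0 < N) {v w : Plane} (h : dist v w < 1 / N) :
    KingAdj (cell N v) (cell N w) := by
  have key : ∀ i, |⌊N * v i⌋ - ⌊N * w i⌋| ≤ 1 := by
    intro i
    have h1 : |v i - w i| < 1 / N := (abs_apply_sub_le_dist v w i).trans_lt h
    rw [lt_div_iff₀ hN] at h1
    have h2 : |N * v i - N * w i| < 1 := by
      rwa [← mul_sub, abs_mul, abs_of_pos hN, mul_comm]
    rw [abs_lt] at h2
    have a1 := Int.floor_le (N * v i)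
    have a2 := Int.lt_floor_add_one (N * v i)
    have a3 := Int.floor_le (N * w i)
    have a4 := Int.lt_floor_add_one (N * w i)
    rw [abs_le]
    constructor
    · have : (⌊N * w i⌋ : ℝ) < ⌊N * v i⌋ + 2 := by linarith
      have : ⌊N * w i⌋ < ⌊N * v i⌋ + 2 := by exact_mod_cast this
      lia
    · have : (⌊N * v i⌋ : ℝ) < ⌊N * w i⌋ + 2 := by linarith
      have : ⌊N * v i⌋ < ⌊N * w i⌋ + 2 := by exact_mod_cast this
      lia
  exact ⟨key 0, key 1⟩

theorem dist_lt_of_kingAdj_cell {N : ℝ} (hN : 0 < N) {v w : Plane}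
    (h : KingAdj (cell N v) (cell N w)) : dist v w < 4 / N := by
  have key : ∀ i, |⌊N * v i⌋ - ⌊N * w i⌋| ≤ 1 → dist (v i) (w i) < 2 / N := by
    intro i hi
    rw [Real.dist_eq, lt_div_iff₀ hN, mul_comm, ← abs_of_pos hN, ← abs_mul, mul_sub,
      abs_lt]
    rw [abs_le] at hi
    have a1 := Int.floor_le (N * v i)
    have a2 := Int.lt_floor_add_one (N * v i)
    have a3 := Int.floor_le (N * w i)
    have a4 := Int.lt_floor_add_one (N * w i)
    have h1 : (⌊N * w i⌋ : ℝ) ≤ ⌊N * v i⌋ + 1 := by exact_mod_cast (by lia)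
    have h2 : (⌊N * v i⌋ : ℝ) ≤ ⌊N * w i⌋ + 1 := by exact_mod_cast (by lia)
    constructor <;> linarith
  have h0 := key 0 h.1
  have h1 := key 1 h.2
  have e : 4 / N = 2 * (2 / N) := by ring
  rw [EuclideanSpace.dist_eq, Fin.sum_univ_two, e, Real.sqrt_lt' (by positivity)]
  nlinarith [dist_nonneg (x := v 0) (y := w 0), dist_nonneg (x := v 1) (y := w 1)]

theorem convex_cell_preimage_Icc {N : ℝ} (a b : ℤ × ℤ) :
    Convex ℝ (cell N ⁻¹' Set.Icc a b) := by
  have e : cell N ⁻¹' Set.Icc a b =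
      {w : Plane | (a.1 : ℝ) ≤ N * w 0 ∧ N * w 0 < b.1 + 1 ∧ (a.2 : ℝ) ≤ N * w 1 ∧
        N * w 1 < b.2 + 1} := by
    ext w
    simp only [cell, Set.mem_preimage, Set.mem_Icc, Prod.le_def, Int.le_floor, Int.floor_le_iff,
      Set.mem_ofPred_eq]
    tauto
  rw [e]
  rintro v ⟨v1, v2, v3, v4⟩ w ⟨w1, w2, w3, w4⟩ s t hs ht hst
  have hc : ∀ i, N * (s • v + t • w) i = s * (N * v i) + t * (N * w i) := by
    intro i
    simp
    ring
  have lo : ∀ {c x y : ℝ}, c ≤ x → c ≤ y → c ≤ s * x + t * y := fun {c x y} hx hy =>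
    (convex_Ici c) hx hy hs ht hst
  have hi : ∀ {c x y : ℝ}, x < c → y < c → s * x + t * y < c := fun {c x y} hx hy =>
    (convex_Iio c) hx hy hs ht hst
  simp only [Set.mem_ofPred_eq, hc]
  exact ⟨lo v1 w1, hi v2 w2, lo v3 w3, hi v4 w4⟩

/-- The cells of mesh `1 / N` that are contained in `Ω`. -/
def cellsInside (N : ℝ) (Ω : Set Plane) : Set (ℤ × ℤ) := {c | ∀ w, cell N w = c → w ∈ Ω}

theorem corner_mem {N : ℝ} (hN : 0 < N) {Ω : Set Plane} {c : ℤ × ℤ} (hc : c ∈ cellsInside N Ω) :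
    corner N c ∈ Ω := hc _ (cell_corner hN c)

theorem exists_bound_cellsInside {N : ℝ} (hN : 0 < N) {Ω : Set Plane}
    (hb : Bornology.IsBounded Ω) :
    ∃ M : ℤ, ∀ c, corner N c ∈ Ω → |c.1| < M ∧ |c.2| < M := by
  obtain ⟨R, hR⟩ := hb.exists_norm_le
  obtain ⟨M, hM⟩ := exists_int_gt (N * R)
  refine ⟨M, fun c hc => ?_⟩
  have key : ∀ i, |corner N c i| ≤ R := fun i =>
    (PiLp.norm_apply_le (corner N c) i).trans (hR _ hc)
  have h0 : |(c.1 : ℝ) / N| ≤ R := key 0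
  have h1 : |(c.2 : ℝ) / N| ≤ R := key 1
  rw [abs_div, abs_of_pos hN, div_le_iff₀ hN] at h0 h1
  constructor
  · have : |(c.1 : ℝ)| < M := by linarith
    exact_mod_cast this
  · have : |(c.2 : ℝ)| < M := by linarith
    exact_mod_cast this

theorem finite_cellsInside {N : ℝ} (hN : 0 < N) {Ω : Set Plane} (hb : Bornology.IsBounded Ω) :
    (cellsInside N Ω).Finite := by
  obtain ⟨M, hM⟩ := exists_bound_cellsInside hN hb
  refine (Set.finite_Icc ((-M, -M) : ℤ × ℤ) (M, M)).subset fun c hc => ?_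
  obtain ⟨h1, h2⟩ := hM c (corner_mem hN hc)
  rw [abs_lt] at h1 h2
  exact ⟨⟨h1.1.le, h2.1.le⟩, ⟨h1.2.le, h2.2.le⟩⟩

theorem escapesUp_cellsInside {N : ℝ} (hN : 0 < N) {Ω : Set Plane} (hb : Bornology.IsBounded Ω)
    (hc : IsPreconnected Ωᶜ) {q : ℤ × ℤ} (hq : q ∉ cellsInside N Ω) :
    EscapesUp (cellsInside N Ω) q := by
  obtain ⟨M, hM⟩ := exists_bound_cellsInside hN hb
  obtain ⟨w, rfl, hw⟩ : ∃ w, cell N w = q ∧ w ∉ Ω := by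
    simpa [cellsInside] using hq
  have hfar : corner N (0, M) ∈ Ωᶜ := fun h => absurd (hM _ h).2 (not_lt.2 (le_abs_self M))
  refine ⟨(0, M), fun c hc => ((le_abs_self _).trans_lt (hM c (corner_mem hN hc)).2).le, ?_⟩
  have := hc.induction₂ (fun v w => Relation.ReflTransGen (KingStep (cellsInside N Ω))
    (cell N v) (cell N w)) ?_ (fun _ _ _ _ _ _ => Relation.ReflTransGen.trans)
    (fun _ _ _ _ h => ?_) hw hfar
  · rwa [cell_corner hN] at this
  · intro v hv
    filter_upwards [self_mem_nhdsWithin,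
      nhdsWithin_le_nhds (Metric.ball_mem_nhds v (one_div_pos.2 hN))] with u hu huv
    exact .single ⟨(kingAdj_cell hN huv).symm, fun h => hv (h v rfl), fun h => hu (h u rfl)⟩
  · have : Std.Symm (KingStep (cellsInside N Ω)) := ⟨fun _ _ h => ⟨h.1.symm, h.2.2, h.2.1⟩⟩
    exact Relation.ReflTransGen.stdSymm.symm _ _ h

theorem cell_preimage_Icc_subset {N : ℝ} {Ω : Set Plane} {a b : ℤ × ℤ}
    (h : Set.Icc a b ⊆ cellsInside N Ω) : cell N ⁻¹' Set.Icc a b ⊆ Ω :=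
  fun w hw => h hw w rfl

theorem RookAdj.Icc_subset {a b : ℤ × ℤ} (h : RookAdj a b) {G : Set (ℤ × ℤ)} (ha : a ∈ G)
    (hb : b ∈ G) : Set.Icc (a ⊓ b) (a ⊔ b) ⊆ G := by
  rintro ⟨c1, c2⟩ ⟨⟨h1, h2⟩, h3, h4⟩
  have hc : (c1, c2) = a ∨ (c1, c2) = b := by
    obtain ⟨a1, a2⟩ := a
    obtain ⟨b1, b2⟩ := b
    have := h.eq_add
    simp only [Prod.mk.injEq, Prod.mk_inf_mk, Prod.mk_sup_mk] at *
    lia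
  rcases hc with h | h <;> rwa [h]

open CategoryTheory in
/-- Over a compact subset of a bounded open set with connected complement, there is a choice of
path classes from a base point that is compatible with all sufficiently short paths. -/
theorem exists_local_primitive {Ω : Set Plane} (hopen : IsOpen Ω) [PathConnectedSpace Ω]
    (hb : Bornology.IsBounded Ω) (hc : IsPreconnected Ωᶜ) {K : Set Plane} (hK : IsCompact K)
    (hKΩ : K ⊆ Ω) (x₀ : Ω) :
    ∃ Θ : ∀ x : Ω, FundamentalGroupoid.mk x₀ ⟶ FundamentalGroupoid.mk x, ∃ δ > 0,
      ∀ (x y : Ω) (p : Path x y), (x : Plane) ∈ K → (y : Plane) ∈ K →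
        (∀ t, dist (x : Plane) (p t) < δ) →
        Θ x ≫ FundamentalGroupoid.fromPath (Path.Homotopic.Quotient.mk p) = Θ y := by
  classical
  obtain ⟨ε, hε, hεΩ⟩ := hK.exists_thickening_subset_open hopen hKΩ
  obtain ⟨N, hN, hNε⟩ : ∃ N : ℝ, 0 < N ∧ 4 / N < ε :=
    ⟨8 / ε, by positivity, by rw [div_div_eq_mul_div, div_lt_iff₀ (by norm_num)]; linarith⟩
  have hnear : ∀ x ∈ K, ∀ c, KingAdj (cell N x) c → c ∈ cellsInside N Ω := by
    rintro x hx c hxc w rfl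
    refine hεΩ (Metric.mem_thickening_iff.2 ⟨x, hx, ?_⟩)
    rw [dist_comm]
    exact (dist_lt_of_kingAdj_cell hN hxc).trans hNε
  obtain ⟨s, hs⟩ := exists_segment_class Ω
  have hs_trans : ∀ L ⊆ Ω, Convex ℝ L → ∀ x y z : Ω, (x : Plane) ∈ L → (y : Plane) ∈ L →
      (z : Plane) ∈ L → FundamentalGroupoid.fromPath (s x y) ≫ FundamentalGroupoid.fromPath (s y z)
        = FundamentalGroupoid.fromPath (s x z) := by
    intro L hLΩ hL x y z hx hy hz
    obtain ⟨p, hp⟩ := hL.exists_path_mem hLΩ hx hy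
    obtain ⟨q, hq⟩ := hL.exists_path_mem hLΩ hy hz
    rw [hs L hLΩ hL x y p hp, hs L hLΩ hL y z q hq, hs L hLΩ hL x z (p.trans q) fun t => ?_]
    · rfl
    · rw [Path.trans_apply]
      split_ifs
      exacts [hp _, hq _]
  have hs_refl : ∀ x : Ω, FundamentalGroupoid.fromPath (s x x) = 𝟙 _ := by
    intro x
    rw [hs {(x : Plane)} (by simp) (convex_singleton _) x x (Path.refl x) (by simp)]
    rfl
  let o : ℤ × ℤ → Ω := fun c => if h : corner N c ∈ Ω then ⟨corner N c, h⟩ else x₀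
  have ho : ∀ c ∈ cellsInside N Ω, (o c : Plane) = corner N c := by
    intro c hc
    simp only [o, dif_pos (corner_mem hN hc)]
  have ho_mem : ∀ a b c, Set.Icc a b ⊆ cellsInside N Ω → c ∈ Set.Icc a b →
      (o c : Plane) ∈ cell N ⁻¹' Set.Icc a b := by
    intro a b c hab hc
    rwa [ho c (hab hc), Set.mem_preimage, cell_corner hN]
  have ho_trans : ∀ a b, Set.Icc a b ⊆ cellsInside N Ω → ∀ c ∈ Set.Icc a b, ∀ d ∈ Set.Icc a b,
      ∀ e ∈ Set.Icc a b, FundamentalGroupoid.fromPath (s (o c) (o d)) ≫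
        FundamentalGroupoid.fromPath (s (o d) (o e)) =
        FundamentalGroupoid.fromPath (s (o c) (o e)) := fun a b hab c hc d hd e he =>
    hs_trans _ (cell_preimage_Icc_subset hab) (convex_cell_preimage_Icc a b) _ _ _
      (ho_mem a b c hab hc) (ho_mem a b d hab hd) (ho_mem a b e hab he)
  have hfin := finite_cellsInside hN hb
  obtain ⟨P, hP⟩ := exists_cocycle_trivialization (fun c => FundamentalGroupoid.mk (o c))
    (fun a b => FundamentalGroupoid.fromPath (s (o a) (o b))) (FundamentalGroupoid.mk x₀)
    (fun a => ⟨FundamentalGroupoid.fromPath (s x₀ (o a))⟩) hfin.toFinset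
    (by
      intro a ha b hb hab
      rw [hfin.mem_toFinset] at ha hb
      rw [ho_trans (a ⊓ b) (a ⊔ b) (hab.Icc_subset ha hb) a ⟨inf_le_left, le_sup_left⟩ b
        ⟨inf_le_right, le_sup_right⟩ a ⟨inf_le_left, le_sup_left⟩, hs_refl])
    (by
      intro i j h1 h2 h3 h4
      rw [hfin.mem_toFinset] at h1 h2 h3 h4
      have hsub : Set.Icc (i, j) (i + 1, j + 1) ⊆ cellsInside N Ω := by
        rintro ⟨a, b⟩ ⟨⟨ha, hb⟩, ha', hb'⟩
        simp only at ha hb ha' hb'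
        rcases (by lia : a = i ∨ a = i + 1) with rfl | rfl <;>
          rcases (by lia : b = j ∨ b = j + 1) with rfl | rfl <;> assumption
      rw [ho_trans _ _ hsub, ho_trans _ _ hsub] <;> simp)
    (by
      intro q hq
      rw [hfin.mem_toFinset] at hq
      rw [hfin.coe_toFinset]
      exact escapesUp_cellsInside hN hb hc hq)
  simp only [hfin.mem_toFinset] at hP
  refine ⟨fun x => P (cell N x) ≫ FundamentalGroupoid.fromPath (s (o (cell N x)) x), 1 / N,
    by positivity, fun x y p hx hy hp => ?_⟩
  set c := cell N x with hc_def
  set d := cell N y with hd_def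
  have hcd : KingAdj c d := kingAdj_cell hN (by simpa using hp 1)
  have hIcc : ∀ e, e ∈ Set.Icc (c.1 - 1, c.2 - 1) (c.1 + 1, c.2 + 1) ↔ KingAdj c e := by
    rintro ⟨e1, e2⟩
    simp only [Set.mem_Icc, Prod.mk_le_mk, KingAdj, abs_le]
    lia
  have hblock : Set.Icc (c.1 - 1, c.2 - 1) (c.1 + 1, c.2 + 1) ⊆ cellsInside N Ω := fun e he =>
    hnear x hx e ((hIcc e).1 he)
  have hblock' := cell_preimage_Icc_subset hblock
  have hconv := convex_cell_preimage_Icc (N := N) (c.1 - 1, c.2 - 1) (c.1 + 1, c.2 + 1)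
  have hcc : KingAdj c c := by simp [KingAdj]
  have hc_mem := ho_mem _ _ c hblock ((hIcc c).2 hcc)
  have hd_mem := ho_mem _ _ d hblock ((hIcc d).2 hcd)
  have hp_mem : ∀ t, (p t : Plane) ∈ cell N ⁻¹' Set.Icc (c.1 - 1, c.2 - 1) (c.1 + 1, c.2 + 1) :=
    fun t => (hIcc _).2 (kingAdj_cell hN (hp t))
  have hx_mem := hp_mem 0
  have hy_mem := hp_mem 1
  rw [p.source] at hx_mem
  rw [p.target] at hy_mem
  have hstep : ∀ a b, KingAdj c a → KingAdj c b → a = b ∨ RookAdj a b →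
      P a ≫ FundamentalGroupoid.fromPath (s (o a) (o b)) = P b := by
    rintro a b ha hb (rfl | hab)
    · rw [hs_refl, Category.comp_id]
    · exact hP a (hnear x hx a ha) b (hnear x hx b hb) hab
  have hPd : P c ≫ FundamentalGroupoid.fromPath (s (o c) (o d)) = P d := by
    have hm : KingAdj c (d.1, c.2) := ⟨hcd.1, by simp⟩
    rw [← ho_trans _ _ hblock c ((hIcc c).2 hcc) (d.1, c.2) ((hIcc _).2 hm) d ((hIcc d).2 hcd),
      ← Category.assoc, hstep c (d.1, c.2) hcc hm, hstep (d.1, c.2) d hm hcd]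
    · obtain ⟨h1, h2⟩ := hcd
      rcases eq_or_ne c.2 d.2 with h | h
      · exact Or.inl (by rw [h])
      · right
        have : 0 < |c.2 - d.2| := abs_pos.2 (sub_ne_zero.2 h)
        simp only [RookAdj, sub_self, abs_zero]
        lia
    · obtain ⟨h1, h2⟩ := hcd
      rcases eq_or_ne c.1 d.1 with h | h
      · exact Or.inl (by rw [← h])
      · right
        have : 0 < |c.1 - d.1| := abs_pos.2 (sub_ne_zero.2 h)
        simp only [RookAdj, sub_self, abs_zero]
        lia
  change (P c ≫ FundamentalGroupoid.fromPath (s (o c) x)) ≫ FundamentalGroupoid.fromPath (.mk p) =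
    P d ≫ FundamentalGroupoid.fromPath (s (o d) y)
  rw [← hs _ hblock' hconv x y p hp_mem, Category.assoc,
    hs_trans _ hblock' hconv _ _ _ hc_mem hx_mem hy_mem, ← hPd, Category.assoc,
    hs_trans _ hblock' hconv _ _ _ hc_mem hd_mem hy_mem]

open CategoryTheory in
/-- A bounded connected open subset of the plane with connected complement is simply connected. -/
theorem simplyConnectedSpace_of_isPreconnected_compl {Ω : Set Plane} (hopen : IsOpen Ω)
    (hconn : IsConnected Ω) (hb : Bornology.IsBounded Ω) (hc : IsPreconnected Ωᶜ) :
    SimplyConnectedSpace Ω := by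
  have hpc : PathConnectedSpace Ω :=
    isPathConnected_iff_pathConnectedSpace.1 (hopen.isConnected_iff_isPathConnected.1 hconn)
  refine simply_connected_iff_paths_homotopic'.2 ⟨hpc, fun {x y} p q => ?_⟩
  obtain ⟨Θ, δ, hδ, hΘ⟩ := exists_local_primitive hopen hb hc
    (K := Subtype.val '' (Set.range p ∪ Set.range q))
    (((isCompact_range p.continuous).union (isCompact_range q.continuous)).image
      continuous_subtype_val) (by simp) x
  have key : ∀ f : C(unitInterval, Ω), Set.range f ⊆ Set.range p ∪ Set.range q →
      ∀ (t t' : unitInterval) (m : Path t t'),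
        Θ (f t) ≫ FundamentalGroupoid.fromPath (.mk (m.map f.continuous)) = Θ (f t') := by
    intro f hf
    have hfK : ∀ t, (f t : Plane) ∈ Subtype.val '' (Set.range p ∪ Set.range q) := fun t =>
      ⟨f t, hf ⟨t, rfl⟩, rfl⟩
    have hsc : SimplyConnectedSpace unitInterval := by
      have := (convex_Icc (0 : ℝ) 1).contractibleSpace ⟨0, by simp⟩
      exact SimplyConnectedSpace.ofContractible (Set.Icc (0 : ℝ) 1)
    have huniq : ∀ (t t' : unitInterval) (m m' : Path t t'),
        FundamentalGroupoid.fromPath (.mk (m.map f.continuous)) =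
          FundamentalGroupoid.fromPath (.mk (m'.map f.continuous)) := fun t t' m m' =>
      Path.Homotopic.Quotient.eq.2 ((SimplyConnectedSpace.paths_homotopic m m').map f)
    have htrans : ∀ (t t' t'' : unitInterval) (m : Path t t') (m' : Path t' t''),
        FundamentalGroupoid.fromPath (.mk (m.map f.continuous)) ≫
          FundamentalGroupoid.fromPath (.mk (m'.map f.continuous)) =
          FundamentalGroupoid.fromPath (.mk ((m.trans m').map f.continuous)) := by
      intro t t' t'' m m'
      rw [Path.map_trans]
      rfl
    have hrefl : ∀ t (m : Path t t), FundamentalGroupoid.fromPath (.mk (m.map f.continuous)) =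
        𝟙 (FundamentalGroupoid.mk (f t)) := by
      intro t m
      rw [huniq t t m (Path.refl t)]
      rfl
    have hsymm : ∀ (t t' : unitInterval), (∀ m : Path t t',
        Θ (f t) ≫ FundamentalGroupoid.fromPath (.mk (m.map f.continuous)) = Θ (f t')) →
        ∀ m : Path t' t,
          Θ (f t') ≫ FundamentalGroupoid.fromPath (.mk (m.map f.continuous)) = Θ (f t) := by
      intro t t' h m
      rw [← h m.symm, Category.assoc, htrans, hrefl, Category.comp_id]
    refine PreconnectedSpace.induction₂' (fun t t' => ∀ m : Path t t',
      Θ (f t) ≫ FundamentalGroupoid.fromPath (.mk (m.map f.continuous)) = Θ (f t')) ?_ ⟨?_⟩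
    · intro t
      have hU : {t' | dist (f t : Plane) (f t') < δ} ∈ 𝓝 t :=
        (isOpen_lt (by fun_prop) continuous_const).mem_nhds (by simpa using hδ)
      obtain ⟨ρ, hρ, hρU⟩ := Metric.mem_nhds_iff.1 hU
      filter_upwards [Metric.ball_mem_nhds t hρ] with t' ht'
      obtain ⟨m, hm⟩ := ((convex_Icc (0 : ℝ) 1).inter (convex_ball (t : ℝ) ρ)).exists_path_mem
        Set.inter_subset_left (x := t) (y := t') ⟨t.2, Metric.mem_ball_self hρ⟩ ⟨t'.2, ht'⟩
      have h : ∀ m : Path t t',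
          Θ (f t) ≫ FundamentalGroupoid.fromPath (.mk (m.map f.continuous)) = Θ (f t') := by
        intro m'
        rw [huniq t t' m' m]
        exact hΘ _ _ _ (hfK t) (hfK t') fun u => hρU (hm u).2
      exact ⟨h, hsymm t t' h⟩
    · intro t t' t'' h h' m
      obtain ⟨m₁⟩ := PathConnectedSpace.joined t t'
      obtain ⟨m₂⟩ := PathConnectedSpace.joined t' t''
      rw [huniq t t'' m (m₁.trans m₂), ← htrans, ← Category.assoc, h m₁, h' m₂]
  have key' : ∀ (f : C(unitInterval, Ω)), Set.range f ⊆ Set.range p ∪ Set.range q →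
      ∀ (x' y' : Ω) (γ : Path x' y'), f 0 = x' → f 1 = y' → (∀ t, γ t = f t) →
        Θ x' ≫ FundamentalGroupoid.fromPath (.mk γ) = Θ y' := by
    rintro f hf x' y' γ rfl rfl hγ
    let m : Path (0 : unitInterval) 1 := ⟨ContinuousMap.id _, rfl, rfl⟩
    have hm : γ = m.map f.continuous := by
      ext t
      rw [hγ]
      rfl
    rw [hm]
    exact key f hf 0 1 m
  have hp := key' p.toContinuousMap Set.subset_union_left x y p p.source p.target fun _ => rfl
  have hq := key' q.toContinuousMap Set.subset_union_right x y q q.source q.target fun _ => rfl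
  exact Path.Homotopic.Quotient.eq.1 ((cancel_epi (Θ x)).1 (hp.trans hq.symm))

theorem isPreconnected_compl_ball (z : Plane) (r : ℝ) : IsPreconnected (Metric.ball z r)ᶜ := by
  by_cases hr : 0 ≤ r
  · have hrank : 1 < Module.rank ℝ Plane := by
      rw [← Module.finrank_eq_rank, finrank_euclideanSpace_fin]
      norm_num
    have hS := isPreconnected_Ici (a := r).prod (isPreconnected_sphere hrank (0 : Plane) 1)
    convert hS.image (fun q : ℝ × Plane => z + q.1 • q.2) (by fun_prop) using 1
    ext w
    simp only [Set.mem_compl_iff, Metric.mem_ball, not_lt, Set.mem_image, Set.mem_prod, Set.mem_Ici,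
      mem_sphere_zero_iff_norm, Prod.exists]
    constructor
    · intro hw
      rcases eq_or_ne w z with rfl | hwz
      · obtain ⟨u, hu⟩ := exists_norm_eq Plane zero_le_one
        rw [dist_self] at hw
        exact ⟨0, u, ⟨hw, hu⟩, by simp⟩
      · refine ⟨dist w z, (dist w z)⁻¹ • (w - z), ⟨hw, ?_⟩, ?_⟩
        · rw [norm_smul, norm_inv, Real.norm_of_nonneg dist_nonneg, dist_eq_norm,
            inv_mul_cancel₀ (norm_ne_zero_iff.2 (sub_ne_zero.2 hwz))]
        · rw [smul_inv_smul₀ (dist_ne_zero.2 hwz), add_sub_cancel]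
    · rintro ⟨t, u, ⟨ht, hu⟩, rfl⟩
      rw [dist_eq_norm, add_sub_cancel_left, norm_smul, hu, mul_one]
      exact ht.trans (le_abs_self t)
  · rw [Metric.ball_eq_empty.2 (not_le.1 hr).le, Set.compl_empty]
    exact isPreconnected_univ

theorem not_isBounded_compl_ball (z : Plane) (r : ℝ) :
    ¬ Bornology.IsBounded (Metric.ball z r)ᶜ := fun h =>
  NormedSpace.unbounded_univ ℝ Plane (Set.union_compl_self (Metric.ball z r) ▸
    Metric.isBounded_ball.union h)

theorem IsClosed.connectedComponentIn {α : Type*} [TopologicalSpace α] {F : Set α}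
    (hF : IsClosed F) {x : α} (hx : x ∈ F) : IsClosed (connectedComponentIn F x) :=
  closure_subset_iff_isClosed.1 <| isPreconnected_connectedComponentIn.closure
    |>.subset_connectedComponentIn (subset_closure (mem_connectedComponentIn hx))
      (hF.closure_subset_iff.2 (connectedComponentIn_subset F x))

/-- The complement of a component of the complement of a connected set is connected. -/
theorem isPreconnected_compl_connectedComponentIn_compl {α : Type*} [TopologicalSpace α]
    [PreconnectedSpace α] {W : Set α} (hW : IsOpen W) (hWc : IsPreconnected W) {a : α}
    (ha : a ∈ Wᶜ) : IsPreconnected (connectedComponentIn Wᶜ a)ᶜ := by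
  set C := connectedComponentIn Wᶜ a with hC
  have hCW : C ⊆ Wᶜ := connectedComponentIn_subset _ _
  have haC : a ∈ C := mem_connectedComponentIn ha
  have hCcl : IsClosed C := hW.isClosed_compl.connectedComponentIn ha
  have key : ∀ u v : Set α, IsOpen u → IsOpen v → Cᶜ ⊆ u ∪ v → Cᶜ ∩ (u ∩ v) = ∅ → W ⊆ u →
      Cᶜ ⊆ u := by
    intro u v hu hv huv hdisj hWu
    have hK : C ∪ Cᶜ ∩ v = (Cᶜ ∩ u)ᶜ := by
      ext x
      have h1 := @huv x
      have h2 : x ∉ Cᶜ ∩ (u ∩ v) := by simp [hdisj]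
      simp only [Set.mem_union, Set.mem_inter_iff, Set.mem_compl_iff] at *
      tauto
    have hKcl : IsClosed (C ∪ Cᶜ ∩ v) := hK ▸ (hCcl.isOpen_compl.inter hu).isClosed_compl
    have hKpre : IsPreconnected (C ∪ Cᶜ ∩ v) := by
      have aux : ∀ A B : Set α, IsClosed A → IsClosed B → C ∪ Cᶜ ∩ v ⊆ A ∪ B → Disjoint A B →
          C ⊆ A → C ∪ Cᶜ ∩ v ⊆ A := by
        intro A B hA hB hAB hd hCA
        have hE : (C ∪ Cᶜ ∩ v) ∩ B = Cᶜ ∩ v ∩ Aᶜ := by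
          ext x
          have h1 := @hAB x
          have h2 := @hCA x
          have h3 : x ∈ A → x ∉ B := fun h => Set.disjoint_left.1 hd h
          simp only [Set.mem_union, Set.mem_inter_iff, Set.mem_compl_iff] at *
          tauto
        have hclopen : IsClopen (Cᶜ ∩ v ∩ Aᶜ) :=
          ⟨hE ▸ hKcl.inter hB, (hCcl.isOpen_compl.inter hv).inter hA.isOpen_compl⟩
        rcases isClopen_iff.1 hclopen with h | h
        · refine Set.union_subset hCA fun x hx => by_contra fun hxA => ?_
          exact (h ▸ (⟨hx, hxA⟩ : x ∈ Cᶜ ∩ v ∩ Aᶜ) : x ∈ (∅ : Set α))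
        · exact absurd haC (h ▸ Set.mem_univ a : a ∈ Cᶜ ∩ v ∩ Aᶜ).1.1
      refine (isPreconnected_iff_subset_of_fully_disjoint_closed hKcl).2 fun A B hA hB hAB hd => ?_
      have hCAB := (isPreconnected_iff_subset_of_fully_disjoint_closed hCcl).1
        isPreconnected_connectedComponentIn A B hA hB (Set.subset_union_left.trans hAB) hd
      rcases hCAB with h | h
      · exact Or.inl (aux A B hA hB hAB hd h)
      · exact Or.inr (aux B A hB hA (Set.union_comm A B ▸ hAB) hd.symm h)
    have hsub : C ∪ Cᶜ ∩ v ⊆ C := by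
      refine hKpre.subset_connectedComponentIn (Or.inl haC) ?_
      rw [hK, Set.compl_subset_compl]
      exact fun x hx => ⟨fun hxC => hCW hxC hx, hWu hx⟩
    intro x hx
    exact (huv hx).elim id fun hxv => absurd (hsub (Or.inr ⟨hx, hxv⟩)) hx
  refine isPreconnected_iff_subset_of_disjoint.2 fun u v hu hv huv hdisj => ?_
  have hWC : W ⊆ Cᶜ := Set.subset_compl_comm.1 hCW
  rcases isPreconnected_iff_subset_of_disjoint.1 hWc u v hu hv (hWC.trans huv)
    (Set.subset_eq_empty (Set.inter_subset_inter_left _ hWC) hdisj) with h | h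
  · exact Or.inl (key u v hu hv huv hdisj h)
  · exact Or.inr (key v u hv hu (Set.union_comm u v ▸ huv) (Set.inter_comm u v ▸ hdisj) h)

/-- The complement of the filled-in set is the unbounded component of the complement. -/
theorem boundedComplementaryFill_eq_compl {z : Plane} {r : ℝ} {W : Set Plane}
    (hW : W ⊆ Metric.ball z r) {a : Plane} (ha : a ∉ Metric.ball z r) :
    boundedComplementaryFill W = (connectedComponentIn Wᶜ a)ᶜ := by
  have hsub : (Metric.ball z r)ᶜ ⊆ connectedComponentIn Wᶜ a :=
    (isPreconnected_compl_ball z r).subset_connectedComponentIn ha (Set.compl_subset_compl.2 hW)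
  ext x
  simp only [boundedComplementaryFill, Set.mem_union, Set.mem_sUnion, Set.mem_ofPred_eq]
  constructor
  · rintro (hx | ⟨K, ⟨⟨y, -, rfl⟩, hb⟩, hx⟩) hxa
    · exact connectedComponentIn_subset _ _ hxa hx
    · rw [connectedComponentIn_eq hx, ← connectedComponentIn_eq hxa] at hb
      exact not_isBounded_compl_ball z r (hb.subset hsub)
  · intro hxa
    by_cases hx : x ∈ W
    · exact Or.inl hx
    refine Or.inr ⟨_, ⟨⟨x, hx, rfl⟩, ?_⟩, mem_connectedComponentIn hx⟩
    refine Metric.isBounded_ball.subset (t := Metric.ball z r) fun y hy => by_contra fun hyb => ?_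
    rw [Set.mem_compl_iff, connectedComponentIn_eq (hsub hyb), ← connectedComponentIn_eq hy] at hxa
    exact hxa (mem_connectedComponentIn hx)

/-- Lemma 4. -/
theorem stmt_1 (X : Set Plane) (hX : IsDendroid X) (z : Plane) (r : ℝ) (hr : 0 < r)
    (hXV : (X ∩ (Metric.closedBall z r)ᶜ).Nonempty)
    (W : Set Plane) (hWU : W ⊆ Metric.ball z r) (hWopen : IsOpen W)
    (hWconn : IsConnected W) (hXW : IsPreconnected (X \ W)) :
    W ⊆ boundedComplementaryFill W ∧
    boundedComplementaryFill W ⊆ Metric.ball z r ∧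
    IsOpen (boundedComplementaryFill W) ∧
    IsConnected (boundedComplementaryFill W) ∧
    Bornology.IsBounded (boundedComplementaryFill W) ∧
    SimplyConnectedSpace ↥(boundedComplementaryFill W) ∧
    IsPreconnected (X \ boundedComplementaryFill W) := by
  obtain ⟨a, haX, hab⟩ := hXV
  have ha : a ∉ Metric.ball z r := fun h => hab (Metric.ball_subset_closedBall h)
  have haW : a ∈ Wᶜ := fun h => ha (hWU h)
  have hsub : W ⊆ boundedComplementaryFill W := Set.subset_union_left
  have heq := boundedComplementaryFill_eq_compl hWU ha
  have hball : boundedComplementaryFill W ⊆ Metric.ball z r := by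
    rw [heq, Set.compl_subset_comm]
    exact (isPreconnected_compl_ball z r).subset_connectedComponentIn ha
      (Set.compl_subset_compl.2 hWU)
  have hopen : IsOpen (boundedComplementaryFill W) :=
    heq ▸ (hWopen.isClosed_compl.connectedComponentIn haW).isOpen_compl
  have hconn : IsConnected (boundedComplementaryFill W) :=
    ⟨hWconn.nonempty.mono hsub,
      heq ▸ isPreconnected_compl_connectedComponentIn_compl hWopen hWconn.isPreconnected haW⟩
  have hb : Bornology.IsBounded (boundedComplementaryFill W) := Metric.isBounded_ball.subset hball
  refine ⟨hsub, hball, hopen, hconn, hb, ?_, ?_⟩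
  · refine simplyConnectedSpace_of_isPreconnected_compl hopen hconn hb ?_
    rw [heq, compl_compl]
    exact isPreconnected_connectedComponentIn
  · have hXC : X \ W ⊆ connectedComponentIn Wᶜ a :=
      hXW.subset_connectedComponentIn ⟨haX, haW⟩ fun x hx => hx.2
    convert hXW using 1
    refine (Set.sdiff_subset_sdiff_right hsub).antisymm fun x hx => ⟨hx.1, ?_⟩
    rw [heq]
    exact fun h => h (hXC hx)
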